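/- Let n, m ∈ ℕ₀ with n ≥ m, let λ ∈ ℂ with Re λ > −1/2, and let x ∈ (−1,1). Then the linearization relation 𝖯_{n+λ}^{−λ}(x) 𝖯_{m+λ}^{−λ}(x) = (2^{λ} Γ(λ+1/2) m! n! (1−x²)^{λ/2} / (√π Γ(2λ+m+1) Γ(2λ+n+1))) · Σ_{k=0}^{m} B^{λ+1/2}_{k,m,n} (Γ(2λ+n+m−2k+1)/(n+m−2k)!) 𝖯_{n+m−2k+λ}^{−λ}(x) holds, where B^{σ}_{k,m,n} := ((m+n+σ−2k)(m+n−2k)! (σ)_k (σ)_{m−k} (σ)_{n−k} (2σ)_{m+n−k}) / ((m+n+σ−k) k! (m−k)! (n−k)! (σ)_{m+n−k} (2σ)_{m+n−2k}). -/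

import Mathlib

/-- Pochhammer symbol `(a)_k = a (a+1) ⋯ (a+k-1)` for complex `a`. -/
noncomputable def cpoch (a : ℂ) (k : ℕ) : ℂ := ∏ i ∈ Finset.range k, (a + i)

/-- Gauss hypergeometric series `₂F₁(a, b; c; z)`. -/
noncomputable def hyp2F1 (a b c z : ℂ) : ℂ :=
  ∑' k : ℕ, cpoch a k * cpoch b k / (cpoch c k * (Nat.factorial k : ℂ)) * z ^ k

/-- Ferrers function of the first kind `𝖯_ν^{−μ}(x)`. -/
noncomputable def ferrersP (ν μ : ℂ) (x : ℝ) : ℂ :=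
  (1 / Complex.Gamma (μ + 1)) * (((1 - x) / (1 + x) : ℝ) : ℂ) ^ (μ / 2) *
    hyp2F1 (-ν) (ν + 1) (μ + 1) (((1 - x) / 2 : ℝ) : ℂ)

/-- Linearization coefficient `B^σ_{k,m,n}` for Gegenbauer polynomials. -/
noncomputable def Bcoef (σ : ℂ) (k m n : ℕ) : ℂ :=
  ((m : ℂ) + n + σ - 2 * k) * (Nat.factorial (m + n - 2 * k) : ℂ) * cpoch σ k *
      cpoch σ (m - k) * cpoch σ (n - k) * cpoch (2 * σ) (m + n - k) /
    (((m : ℂ) + n + σ - k) * (Nat.factorial k : ℂ) * (Nat.factorial (m - k) : ℂ) *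
      (Nat.factorial (n - k) : ℂ) * cpoch σ (m + n - k) * cpoch (2 * σ) (m + n - 2 * k))

theorem cpoch_zero (a : ℂ) : cpoch a 0 = 1 := by simp [cpoch]

theorem cpoch_succ (a : ℂ) (k : ℕ) : cpoch a (k + 1) = cpoch a k * (a + k) := by
  simp [cpoch, Finset.prod_range_succ]

theorem cpoch_succ_left (a : ℂ) (k : ℕ) : cpoch a (k + 1) = a * cpoch (a + 1) k := by
  simp only [cpoch, Finset.prod_range_succ', Nat.cast_zero, add_zero]
  rw [mul_comm]
  congr 1
  refine Finset.prod_congr rfl fun i _ => ?_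
  push_cast
  ring

theorem add_natCast_ne_zero_of_re_pos {a : ℂ} (ha : 0 < a.re) (k : ℕ) : a + k ≠ 0 := by
  intro h
  have := congrArg Complex.re h
  simp only [Complex.add_re, Complex.natCast_re, Complex.zero_re] at this
  have hk : (0 : ℝ) ≤ k := k.cast_nonneg
  linarith

theorem cpoch_ne_zero_of_re_pos {a : ℂ} (ha : 0 < a.re) (k : ℕ) : cpoch a k ≠ 0 :=
  Finset.prod_ne_zero_iff.mpr fun i _ => add_natCast_ne_zero_of_re_pos ha i

theorem cpoch_mul_Gamma {a : ℂ} (ha : 0 < a.re) (k : ℕ) :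
    Complex.Gamma (a + k) = cpoch a k * Complex.Gamma a := by
  induction k with
  | zero => simp [cpoch_zero]
  | succ k ih =>
    rw [Nat.cast_succ, ← add_assoc,
      Complex.Gamma_add_one _ (add_natCast_ne_zero_of_re_pos ha k), ih, cpoch_succ]
    ring

theorem cpoch_eq_ascPochhammer (a : ℂ) (k : ℕ) : cpoch a k = (ascPochhammer ℂ k).eval a := by
  induction k with
  | zero => simp [cpoch_zero]
  | succ k ih => rw [cpoch_succ, ih, ascPochhammer_succ_eval]

/-- The coefficient of `z ^ k` in `₂F₁(a, b; c; z)`. -/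
noncomputable def hypCoef (a b c : ℂ) (k : ℕ) : ℂ :=
  cpoch a k * cpoch b k / (cpoch c k * (Nat.factorial k : ℂ))

theorem hypCoef_succ (a b c : ℂ) (k : ℕ) :
    hypCoef a b c (k + 1) = hypCoef a b c k * ((a + k) / (c + k) * ((b + k) / (1 + k))) := by
  simp only [hypCoef, cpoch_succ, Nat.factorial_succ]
  push_cast
  rw [add_comm (k : ℂ) 1]
  simp only [div_eq_mul_inv, mul_inv]
  ring

theorem tendsto_add_natCast_div_add_natCast (a c : ℂ) :
    Filter.Tendsto (fun k : ℕ => (a + k) / (c + k)) Filter.atTop (nhds 1) := by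
  simpa using tendsto_add_mul_div_add_mul_atTop_nhds a c (1 : ℂ) (one_ne_zero (α := ℂ))

theorem summable_hypCoef_mul_pow (a b c : ℂ) {z : ℂ} (hz : ‖z‖ < 1) :
    Summable fun k => hypCoef a b c k * z ^ k := by
  obtain ⟨r, hzr, hr⟩ := exists_between hz
  refine summable_of_ratio_norm_eventually_le hr ?_
  have h : Filter.Tendsto
      (fun k : ℕ => ‖(a + k) / (c + k) * ((b + k) / (1 + k)) * z‖) Filter.atTop (nhds ‖z‖) := by
    simpa using (((tendsto_add_natCast_div_add_natCast a c).mul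
      (tendsto_add_natCast_div_add_natCast b 1)).mul_const z).norm
  filter_upwards [h.eventually_le_const hzr] with k hk
  rw [hypCoef_succ, pow_succ,
    show hypCoef a b c k * ((a + k) / (c + k) * ((b + k) / (1 + k))) * (z ^ k * z) =
      ((a + k) / (c + k) * ((b + k) / (1 + k)) * z) * (hypCoef a b c k * z ^ k) by ring, norm_mul]
  exact mul_le_mul_of_nonneg_right hk (norm_nonneg _)

theorem hyp2F1_eq_tsum (a b c z : ℂ) : hyp2F1 a b c z = ∑' k, hypCoef a b c k * z ^ k := rfl

theorem hypCoef_contiguous (ν c : ℂ) (hc : 0 < c.re) (k : ℕ) :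
    (ν + c) * hypCoef (-(ν + 1)) (ν + 1 + 1) c (k + 1) +
        (ν + 1 - c) * hypCoef (-(ν - 1)) (ν - 1 + 1) c (k + 1) -
        (2 * ν + 1) * hypCoef (-ν) (ν + 1) c (k + 1) =
      -2 * (2 * ν + 1) * hypCoef (-ν) (ν + 1) c k := by
  have e₁ : cpoch (-(ν + 1)) (k + 1) * cpoch (ν + 1 + 1) (k + 1) =
      -(cpoch (-ν) k * cpoch (ν + 1) k * (ν + 1 + k) * (ν + 1 + 1 + k)) := by
    have h := cpoch_succ_left (ν + 1) k
    rw [cpoch_succ] at h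
    rw [cpoch_succ_left, cpoch_succ (ν + 1 + 1), show -(ν + 1) + 1 = -ν by ring]
    linear_combination (ν + 1 + 1 + k) * cpoch (-ν) k * h
  have e₂ : cpoch (-(ν - 1)) (k + 1) * cpoch (ν - 1 + 1) (k + 1) =
      -(cpoch (-ν) k * cpoch (ν + 1) k * (-ν + k) * (-ν + 1 + k)) := by
    have h := cpoch_succ_left (-ν) k
    rw [cpoch_succ] at h
    rw [cpoch_succ_left (ν - 1 + 1), cpoch_succ (-(ν - 1)), show -(ν - 1) = -ν + 1 by ring,
      show ν - 1 + 1 = ν by ring]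
    linear_combination (-ν + 1 + k) * cpoch (ν + 1) k * h
  have hk : (k : ℂ) + 1 ≠ 0 := Nat.cast_add_one_ne_zero k
  have hf : (Nat.factorial k : ℂ) ≠ 0 := Nat.cast_ne_zero.mpr k.factorial_ne_zero
  have hck := add_natCast_ne_zero_of_re_pos hc k
  have hcp := cpoch_ne_zero_of_re_pos hc k
  simp only [hypCoef, e₁, e₂]
  simp only [cpoch_succ, Nat.factorial_succ]
  push_cast
  field_simp
  ring

theorem hyp2F1_contiguous (ν c z : ℂ) (hc : 0 < c.re) (hz : ‖z‖ < 1) :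
    (ν + c) * hyp2F1 (-(ν + 1)) (ν + 1 + 1) c z =
      (2 * ν + 1) * (1 - 2 * z) * hyp2F1 (-ν) (ν + 1) c z -
        (ν + 1 - c) * hyp2F1 (-(ν - 1)) (ν - 1 + 1) c z := by
  simp only [hyp2F1_eq_tsum]
  have s₁ := (summable_hypCoef_mul_pow (-(ν + 1)) (ν + 1 + 1) c hz).hasSum.mul_left (ν + c)
  have s₂ := (summable_hypCoef_mul_pow (-(ν - 1)) (ν - 1 + 1) c hz).hasSum.mul_left (ν + 1 - c)
  have s₃ := (summable_hypCoef_mul_pow (-ν) (ν + 1) c hz).hasSum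
  have s := (s₁.add s₂).sub (s₃.mul_left (2 * ν + 1))
  have h := s.summable.tsum_eq_zero_add
  have hshift (k : ℕ) :
      (ν + c) * (hypCoef (-(ν + 1)) (ν + 1 + 1) c (k + 1) * z ^ (k + 1)) +
            (ν + 1 - c) * (hypCoef (-(ν - 1)) (ν - 1 + 1) c (k + 1) * z ^ (k + 1)) -
          (2 * ν + 1) * (hypCoef (-ν) (ν + 1) c (k + 1) * z ^ (k + 1)) =
        -2 * (2 * ν + 1) * z * (hypCoef (-ν) (ν + 1) c k * z ^ k) := by
    rw [pow_succ]
    linear_combination z ^ k * z * hypCoef_contiguous ν c hc k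
  have hzero (a b : ℂ) : hypCoef a b c 0 = 1 := by simp [hypCoef, cpoch_zero]
  rw [s.tsum_eq, tsum_congr hshift, tsum_mul_left, hzero, hzero, hzero] at h
  linear_combination h

theorem hypCoef_neg_self {a b : ℂ} (hb : 0 < b.re) (k : ℕ) :
    hypCoef (-a) b b k = (-1) ^ k * Ring.choose a k := by
  have h := Ring.factorial_nsmul_multichoose_eq_ascPochhammer (-a) k
  rw [Polynomial.ascPochhammer_smeval_eq_eval, ← cpoch_eq_ascPochhammer, Ring.multichoose_eq,
    nsmul_eq_mul] at h
  have h' := Ring.choose_neg (-a) k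
  rw [neg_neg] at h'
  have hf : (Nat.factorial k : ℂ) ≠ 0 := Nat.cast_ne_zero.mpr k.factorial_ne_zero
  have hp : ((-1 : ℂ) ^ k) * (-1) ^ k = 1 := by rw [← mul_pow]; simp
  rw [hypCoef, mul_comm (cpoch b k), mul_div_mul_right _ _ (cpoch_ne_zero_of_re_pos hb k), ← h,
    mul_div_cancel_left₀ _ hf, h', Units.smul_def, zsmul_eq_mul]
  rw [Int.coe_negOnePow_natCast, ← mul_assoc]
  push_cast
  rw [hp, one_mul]

theorem hyp2F1_neg_self {a b z : ℂ} (hb : 0 < b.re) (hz : ‖z‖ < 1) :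
    hyp2F1 (-a) b b z = (1 - z) ^ a := by
  have h := (Complex.one_add_cpow_hasFPowerSeriesOnBall_zero (a := a)).hasSum (y := -z)
    (by rw [← ENNReal.ofReal_one, Metric.eball_ofReal]; simpa using hz)
  rw [zero_add, ← sub_eq_add_neg] at h
  rw [hyp2F1_eq_tsum, ← h.tsum_eq]
  refine tsum_congr fun k => ?_
  rw [hypCoef_neg_self hb, binomialSeries_apply]
  simp only [List.ofFn_const, List.prod_replicate, smul_eq_mul]
  rw [neg_pow z]
  ring

/-- The ratio `(σ)_a / a!`. -/
noncomputable def pochRatio (σ : ℂ) (a : ℕ) : ℂ := cpoch σ a / (Nat.factorial a : ℂ)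

/-- The ratio `(σ)_{a-1} / (a-1)!`, read as `0` when `a = 0`. -/
noncomputable def pochRatioPred (σ : ℂ) : ℕ → ℂ
  | 0 => 0
  | a + 1 => pochRatio σ a

/-- The ratio `(2σ)_s / (σ)_{s+1}`. -/
noncomputable def doublingRatio (σ : ℂ) (s : ℕ) : ℂ := cpoch (2 * σ) s / cpoch σ (s + 1)

theorem pochRatio_succ (σ : ℂ) (a : ℕ) :
    pochRatio σ (a + 1) = pochRatio σ a * ((σ + a) / (a + 1)) := by
  simp only [pochRatio, cpoch_succ, Nat.factorial_succ]
  push_cast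
  simp only [div_eq_mul_inv, mul_inv]
  ring

theorem pochRatio_zero (σ : ℂ) : pochRatio σ 0 = 1 := by simp [pochRatio, cpoch_zero]

theorem doublingRatio_succ (σ : ℂ) (s : ℕ) :
    doublingRatio σ (s + 1) = doublingRatio σ s * ((2 * σ + s) / (σ + s + 1)) := by
  simp only [doublingRatio, cpoch_succ]
  push_cast
  simp only [div_eq_mul_inv, mul_inv]
  ring

/-- The coefficient `B^σ_{k,k+i,k+j} (2σ)_{i+j} / (i+j)!`. -/
noncomputable def linCoef (σ : ℂ) (k i j : ℕ) : ℂ :=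
  (i + j + σ) * (pochRatio σ k * pochRatio σ i * pochRatio σ j * doublingRatio σ (i + j + k))

theorem linCoef_recurrence {σ : ℂ} (hσ : 0 < σ.re) (k i j : ℕ) :
    ((k : ℂ) + i) * linCoef σ k i j =
      (k + i - 1 + σ) *
          (pochRatio σ k * pochRatioPred σ i * pochRatio σ j * doublingRatio σ (i + j + k - 1) *
              (2 * σ + i + j - 1) +
            pochRatioPred σ k * pochRatio σ i * pochRatio σ (j + 1) * doublingRatio σ (i + j + k) *
              (i + j + 1)) -
        (k + i + 2 * σ - 2) * (i + j + σ) *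
          (pochRatioPred σ k * pochRatioPred σ i * pochRatio σ (j + 1) *
            doublingRatio σ (i + j + k - 1)) := by
  have hs := add_natCast_ne_zero_of_re_pos hσ
  have hj : (j : ℂ) + 1 ≠ 0 := Nat.cast_add_one_ne_zero j
  rcases k with _ | k <;> rcases i with _ | i
  · simp [pochRatioPred]
  · have hi : (i : ℂ) + 1 ≠ 0 := Nat.cast_add_one_ne_zero i
    have hw := hs (i + j + 1)
    push_cast at hw
    rw [show i + 1 + j + 0 = i + j + 1 by ring]
    simp only [linCoef, show i + 1 + j + 0 = i + j + 1 by ring, pochRatioPred, pochRatio_succ,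
      doublingRatio_succ, Nat.add_sub_cancel]
    push_cast
    rw [add_assoc σ ((i : ℂ) + j) 1]
    field_simp
    ring
  · have hk : (k : ℂ) + 1 ≠ 0 := Nat.cast_add_one_ne_zero k
    have hw := hs (j + k + 1)
    push_cast at hw
    simp only [linCoef, show 0 + j + (k + 1) = j + k + 1 by ring, pochRatioPred, pochRatio_succ,
      doublingRatio_succ, Nat.add_sub_cancel]
    push_cast
    rw [add_assoc σ ((j : ℂ) + k) 1]
    field_simp
    ring
  · have hi : (i : ℂ) + 1 ≠ 0 := Nat.cast_add_one_ne_zero i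
    have hk : (k : ℂ) + 1 ≠ 0 := Nat.cast_add_one_ne_zero k
    have hw := hs (i + j + k + 1 + 1)
    push_cast at hw
    simp only [linCoef, show i + 1 + j + (k + 1) = i + j + k + 1 + 1 by ring, pochRatioPred,
      pochRatio_succ, doublingRatio_succ σ (i + j + k + 1), Nat.add_sub_cancel]
    push_cast
    rw [show σ + ((i : ℂ) + j + k + 1) + 1 = σ + (i + j + k + 1 + 1) by ring]
    field_simp
    ring

theorem linCoef_zero_left {σ : ℂ} (hσ : 0 < σ.re) (n : ℕ) :
    linCoef σ 0 0 n = pochRatio (2 * σ) n := by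
  have h := add_natCast_ne_zero_of_re_pos hσ n
  have h' := cpoch_ne_zero_of_re_pos hσ n
  have hf : (Nat.factorial n : ℂ) ≠ 0 := Nat.cast_ne_zero.mpr n.factorial_ne_zero
  simp only [linCoef, doublingRatio, pochRatio, zero_add, add_zero, cpoch_zero,
    cpoch_succ, Nat.factorial_zero, Nat.cast_zero, Nat.cast_one]
  field_simp
  ring

section Linearization

variable {σ x : ℂ} {q : ℕ → ℂ}

theorem pochRatio_mul_recurrence
    (hq : ∀ n : ℕ, (2 * σ + n) * q (n + 1) = 2 * (n + σ) * x * q n - n * q (n - 1)) (m : ℕ) :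
    ((m : ℂ) + 1) * (pochRatio (2 * σ) (m + 1) * q (m + 1)) =
      2 * (m + σ) * x * (pochRatio (2 * σ) m * q m) -
        (m + 2 * σ - 1) * (pochRatioPred (2 * σ) m * q (m - 1)) := by
  have hm : (m : ℂ) + 1 ≠ 0 := Nat.cast_add_one_ne_zero m
  have h₁ : ((m : ℂ) + 1) * pochRatio (2 * σ) (m + 1) =
      pochRatio (2 * σ) m * (2 * σ + m) := by
    rw [pochRatio_succ]
    field_simp
  have h₂ : m * pochRatio (2 * σ) m = (m + 2 * σ - 1) * pochRatioPred (2 * σ) m := by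
    rcases m with _ | m
    · simp [pochRatioPred]
    · have hm : (m : ℂ) + 1 ≠ 0 := Nat.cast_add_one_ne_zero m
      rw [pochRatio_succ, pochRatioPred]
      push_cast
      field_simp
      ring
  linear_combination q (m + 1) * h₁ + pochRatio (2 * σ) m * hq m - q (m - 1) * h₂

/-- The sum `∑ₖ B^σ_{k,m,n} (2σ)_{m+n-2k} / (m+n-2k)! q_{m+n-2k}`. -/
noncomputable def linSum (σ : ℂ) (q : ℕ → ℂ) (m n : ℕ) : ℂ :=
  ∑ k ∈ Finset.range (m + 1), linCoef σ k (m - k) (n - k) * q (m + n - 2 * k)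

/-- `linSum` at the predecessor of `m`, read as `0` when `m = 0`. -/
noncomputable def linSumPred (σ : ℂ) (q : ℕ → ℂ) : ℕ → ℕ → ℂ
  | 0, _ => 0
  | m + 1, n => linSum σ q m n

theorem linSum_recurrence (hσ : 0 < σ.re)
    (hq : ∀ n : ℕ, (2 * σ + n) * q (n + 1) = 2 * (n + σ) * x * q n - n * q (n - 1))
    {m n : ℕ} (hmn : m + 1 ≤ n) :
    ((m : ℂ) + 1) * linSum σ q (m + 1) n =
      2 * (m + σ) * x * linSum σ q m n - (m + 2 * σ - 1) * linSumPred σ q m n := by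
  let up (k : ℕ) : ℂ :=
    pochRatio σ k * pochRatioPred σ (m + 1 - k) * pochRatio σ (n - k) *
      doublingRatio σ (m + n - k) * (2 * σ + m + n - 2 * k) * q (m + 1 + n - 2 * k)
  let down (k : ℕ) : ℂ :=
    pochRatioPred σ k * pochRatio σ (m + 1 - k) * pochRatio σ (n - k + 1) *
      doublingRatio σ (m + 1 + n - k) * (m + 1 + n - 2 * k + 1) * q (m + 1 + n - 2 * k)
  let prev (k : ℕ) : ℂ :=
    (m + 1 + n - 2 * k + σ) * (pochRatioPred σ k * pochRatioPred σ (m + 1 - k) *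
      pochRatio σ (n - k + 1) * doublingRatio σ (m + n - k)) * q (m + 1 + n - 2 * k)
  have hsplit : ((m : ℂ) + 1) * linSum σ q (m + 1) n =
      (m + σ) * (∑ k ∈ Finset.range (m + 2), up k + ∑ k ∈ Finset.range (m + 2), down k) -
        (m + 2 * σ - 1) * ∑ k ∈ Finset.range (m + 2), prev k := by
    simp only [linSum, ← Finset.sum_add_distrib, Finset.mul_sum, ← Finset.sum_sub_distrib]
    refine Finset.sum_congr rfl fun k hk => ?_
    obtain ⟨i, hi⟩ := Nat.exists_eq_add_of_le (Nat.lt_succ_iff.mp (Finset.mem_range.mp hk))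
    obtain ⟨j, rfl⟩ := Nat.exists_eq_add_of_le (show k ≤ n by omega)
    have hm : (m : ℂ) = k + i - 1 := by
      have := congrArg (Nat.cast : ℕ → ℂ) hi
      push_cast at this
      linear_combination this
    have h := linCoef_recurrence hσ k i j
    simp only [up, down, prev, show m + 1 - k = i by omega, show k + j - k = j by omega,
      show m + (k + j) - k = i + j + k - 1 by omega,
      show m + 1 + (k + j) - k = i + j + k by omega, hm]
    push_cast
    linear_combination q (m + 1 + (k + j) - 2 * k) * h
  have hup_down : ∑ k ∈ Finset.range (m + 2), up k + ∑ k ∈ Finset.range (m + 2), down k =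
      2 * x * linSum σ q m n := by
    rw [Finset.sum_range_succ, Finset.sum_range_succ' down,
      show up (m + 1) = 0 by simp [up, pochRatioPred],
      show down 0 = 0 by simp [down, pochRatioPred], add_zero, add_zero,
      ← Finset.sum_add_distrib, linSum, Finset.mul_sum]
    refine Finset.sum_congr rfl fun k hk => ?_
    obtain ⟨i, rfl⟩ := Nat.exists_eq_add_of_le (Nat.lt_succ_iff.mp (Finset.mem_range.mp hk))
    obtain ⟨j, rfl⟩ := Nat.exists_eq_add_of_le (show k + 1 ≤ n by omega)
    have h := hq (i + j + 1)
    simp only [up, down, linCoef, show k + i + 1 - k = i + 1 by omega,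
      show k + i + 1 - (k + 1) = i by omega, show k + i - k = i by omega,
      show k + 1 + j - k = j + 1 by omega, show k + 1 + j - (k + 1) = j by omega,
      show k + i + (k + 1 + j) - k = i + j + k + 1 by omega,
      show i + (j + 1) + k = i + j + k + 1 by omega,
      show k + i + 1 + (k + 1 + j) - (k + 1) = i + j + k + 1 by omega,
      show k + i + (k + 1 + j) - 2 * k = i + j + 1 by omega,
      show k + i + 1 + (k + 1 + j) - 2 * k = i + j + 1 + 1 by omega,
      show k + i + 1 + (k + 1 + j) - 2 * (k + 1) = i + j by omega, pochRatioPred]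
    rw [Nat.add_sub_cancel] at h
    push_cast at h ⊢
    linear_combination pochRatio σ k * pochRatio σ i * pochRatio σ (j + 1) *
      doublingRatio σ (i + j + k + 1) * h
  have hprev : ∑ k ∈ Finset.range (m + 2), prev k = linSumPred σ q m n := by
    rw [Finset.sum_range_succ, Finset.sum_range_succ',
      show prev (m + 1) = 0 by simp [prev, pochRatioPred],
      show prev 0 = 0 by simp [prev, pochRatioPred], add_zero, add_zero]
    rcases m with _ | m
    · simp [linSumPred]
    · rw [linSumPred, linSum]
      refine Finset.sum_congr rfl fun k hk => ?_
      obtain ⟨i, rfl⟩ := Nat.exists_eq_add_of_le (Nat.lt_succ_iff.mp (Finset.mem_range.mp hk))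
      obtain ⟨j, rfl⟩ := Nat.exists_eq_add_of_le (show k + 1 ≤ n by omega)
      simp only [prev, linCoef, show k + i + 1 + 1 - (k + 1) = i + 1 by omega,
        show k + i - k = i by omega, show k + 1 + j - k = j + 1 by omega,
        show k + 1 + j - (k + 1) = j by omega,
        show k + i + 1 + (k + 1 + j) - (k + 1) = i + (j + 1) + k by omega,
        show k + i + 1 + 1 + (k + 1 + j) - 2 * (k + 1) = i + j + 1 by omega,
        show k + i + (k + 1 + j) - 2 * k = i + j + 1 by omega, pochRatioPred]
      push_cast
      ring
  rw [hsplit, hup_down, hprev]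
  ring

/-- Linearization of products for solutions of the Gegenbauer three-term recurrence, normalized so
that `pochRatio (2 * σ) n * q n / q 0` is the Gegenbauer polynomial. -/
theorem pochRatio_mul_mul_eq_linSum (hσ : 0 < σ.re)
    (hq : ∀ n : ℕ, (2 * σ + n) * q (n + 1) = 2 * (n + σ) * x * q n - n * q (n - 1)) (n : ℕ) :
    ∀ m ≤ n, pochRatio (2 * σ) m * q m * (pochRatio (2 * σ) n * q n) = q 0 * linSum σ q m n := by
  intro m
  induction m using Nat.strong_induction_on with
  | _ m ih =>
    intro hm
    rcases m with _ | m
    · simp [linSum, linCoef_zero_left hσ, pochRatio_zero]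
    · have h₁ := ih m m.lt_succ_self (by omega)
      have h₂ : pochRatioPred (2 * σ) m * q (m - 1) * (pochRatio (2 * σ) n * q n) =
          q 0 * linSumPred σ q m n := by
        rcases m with _ | m
        · simp [pochRatioPred, linSumPred]
        · exact ih m (by omega) (by omega)
      refine mul_left_cancel₀ (Nat.cast_add_one_ne_zero (R := ℂ) m) ?_
      linear_combination (pochRatio (2 * σ) n * q n) * pochRatio_mul_recurrence hq m -
        q 0 * linSum_recurrence hσ hq hm + 2 * (m + σ) * x * h₁ - (m + 2 * σ - 1) * h₂

end Linearization

theorem hyp2F1_gegenbauer_recurrence {lam z : ℂ} (hlam : 0 < (lam + 1).re) (hz : ‖z‖ < 1)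
    (n : ℕ) :
    (2 * (lam + 1 / 2) + n) *
        hyp2F1 (-(((n + 1 : ℕ) : ℂ) + lam)) (((n + 1 : ℕ) : ℂ) + lam + 1) (lam + 1) z =
      2 * (n + (lam + 1 / 2)) * (1 - 2 * z) *
          hyp2F1 (-((n : ℂ) + lam)) ((n : ℂ) + lam + 1) (lam + 1) z -
        n * hyp2F1 (-(((n - 1 : ℕ) : ℂ) + lam)) (((n - 1 : ℕ) : ℂ) + lam + 1) (lam + 1) z := by
  have h := hyp2F1_contiguous ((n : ℂ) + lam) (lam + 1) z hlam hz
  rw [show ((n + 1 : ℕ) : ℂ) + lam = n + lam + 1 by push_cast; ring]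
  rcases n with _ | n
  · simp only [Nat.cast_zero, zero_add, zero_mul, sub_self, sub_zero] at h ⊢
    linear_combination h
  · rw [Nat.add_sub_cancel]
    rw [show ((n + 1 : ℕ) : ℂ) + lam - 1 = n + lam by push_cast; ring] at h
    push_cast at h ⊢
    linear_combination h

theorem Bcoef_mul_Gamma_div_factorial {lam : ℂ} (hlam : 0 < (lam + 1 / 2).re) {k m n : ℕ}
    (hkm : k ≤ m) (hkn : k ≤ n) :
    Bcoef (lam + 1 / 2) k m n * (Complex.Gamma (2 * lam + n + m - 2 * k + 1) /
        (Nat.factorial (n + m - 2 * k) : ℂ)) =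
      linCoef (lam + 1 / 2) k (m - k) (n - k) * Complex.Gamma (2 * lam + 1) := by
  obtain ⟨i, rfl⟩ := Nat.exists_eq_add_of_le hkm
  obtain ⟨j, rfl⟩ := Nat.exists_eq_add_of_le hkn
  have hlam' : 0 < (2 * (lam + 1 / 2)).re := by
    simp only [Complex.mul_re, Complex.re_ofNat, Complex.im_ofNat, zero_mul, sub_zero]
    linarith
  have hΓ := cpoch_mul_Gamma hlam' (i + j)
  rw [show 2 * (lam + 1 / 2) + ((i + j : ℕ) : ℂ) =
      2 * lam + ((k + j : ℕ) : ℂ) + ((k + i : ℕ) : ℂ) - 2 * k + 1 by push_cast; ring] at hΓ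
  have h₁ := add_natCast_ne_zero_of_re_pos hlam (i + j + k)
  have h₂ := cpoch_ne_zero_of_re_pos hlam (i + j + k)
  have h₃ := cpoch_ne_zero_of_re_pos hlam' (i + j)
  have hf (a : ℕ) : (Nat.factorial a : ℂ) ≠ 0 := Nat.cast_ne_zero.mpr a.factorial_ne_zero
  have hk := hf k
  have hi := hf i
  have hj := hf j
  have hij := hf (i + j)
  rw [hΓ, show 2 * lam + 1 = 2 * (lam + 1 / 2) by ring]
  simp only [Bcoef, linCoef, pochRatio, doublingRatio, cpoch_succ,
    show k + i - k = i by omega, show k + j - k = j by omega,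
    show k + i + (k + j) - 2 * k = i + j by omega, show k + j + (k + i) - 2 * k = i + j by omega,
    show k + i + (k + j) - k = i + j + k by omega]
  generalize lam + 1 / 2 = σ at hlam hlam' h₁ h₂ h₃ ⊢
  rw [show ((k + i : ℕ) : ℂ) + ((k + j : ℕ) : ℂ) + σ - 2 * k = i + j + σ by push_cast; ring,
    show ((k + i : ℕ) : ℂ) + ((k + j : ℕ) : ℂ) + σ - k = σ + ((i + j + k : ℕ) : ℂ) by
      push_cast; ring]
  generalize 2 * σ = τ at h₃ ⊢
  field_simp

theorem Gamma_half_add_mul_Gamma_add_one (lam : ℂ) :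
    (2 : ℂ) ^ lam * 2 ^ lam * (Complex.Gamma (lam + 1 / 2) * Complex.Gamma (lam + 1)) =
      (Real.sqrt Real.pi : ℂ) * Complex.Gamma (2 * lam + 1) := by
  have h := Complex.Gamma_mul_Gamma_add_half (lam + 1 / 2)
  rw [show lam + 1 / 2 + 1 / 2 = lam + 1 by ring, show 2 * (lam + 1 / 2) = 2 * lam + 1 by ring,
    show 1 - (2 * lam + 1) = -lam + -lam by ring, Complex.cpow_add _ _ two_ne_zero,
    Complex.cpow_neg] at h
  have h2 : (2 : ℂ) ^ lam ≠ 0 := by simp [Complex.cpow_eq_zero_iff]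
  rw [h]
  field_simp

theorem cpow_half_mul_cpow {x : ℝ} (hx : x ∈ Set.Ioo (-1 : ℝ) 1) (lam : ℂ) :
    (((1 - x) / (1 + x) : ℝ) : ℂ) ^ (lam / 2) * (1 - (((1 - x) / 2 : ℝ) : ℂ)) ^ lam * 2 ^ lam =
      ((1 - x ^ 2 : ℝ) : ℂ) ^ (lam / 2) := by
  have h₁ : 0 < 1 - x := by linarith [hx.2]
  have h₂ : 0 < 1 + x := by linarith [hx.1]
  have h2 : (2 : ℂ) ^ lam = ((2 : ℝ) : ℂ) ^ lam := by norm_num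
  have h₃ : ((1 + x : ℝ) : ℂ) ^ lam =
      ((1 + x : ℝ) : ℂ) ^ (lam / 2) * ((1 + x : ℝ) : ℂ) ^ (lam / 2) := by
    rw [← Complex.cpow_add _ _ (Complex.ofReal_ne_zero.mpr h₂.ne'), add_halves]
  have h₄ : ((1 + x : ℝ) : ℂ) ^ (lam / 2) ≠ 0 := by
    simp [Complex.cpow_eq_zero_iff, -Complex.ofReal_add, h₂.ne']
  rw [mul_assoc, show 1 - (((1 - x) / 2 : ℝ) : ℂ) = (((1 + x) / 2 : ℝ) : ℂ) by push_cast; ring,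
    h2, ← Complex.mul_cpow_ofReal_nonneg (by positivity) zero_le_two, ← Complex.ofReal_mul,
    div_mul_cancel₀ _ (two_ne_zero (α := ℝ)), Complex.ofReal_div,
    Complex.div_cpow_ofReal_nonneg h₁.le h₂.le, h₃,
    show 1 - x ^ 2 = (1 - x) * (1 + x) by ring, Complex.ofReal_mul,
    Complex.mul_cpow_ofReal_nonneg h₁.le h₂.le]
  field_simp

theorem ferrersP_linearization (n m : ℕ) (hnm : m ≤ n) (lam : ℂ)
    (hlam : -(1 / 2 : ℝ) < lam.re) (x : ℝ) (hx : x ∈ Set.Ioo (-1 : ℝ) 1) :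
    ferrersP ((n : ℂ) + lam) lam x * ferrersP ((m : ℂ) + lam) lam x =
      (2 : ℂ) ^ lam * Complex.Gamma (lam + 1 / 2) * (Nat.factorial m : ℂ) *
          (Nat.factorial n : ℂ) * ((1 - x ^ 2 : ℝ) : ℂ) ^ (lam / 2) /
          ((Real.sqrt Real.pi : ℂ) * Complex.Gamma (2 * lam + m + 1) *
            Complex.Gamma (2 * lam + n + 1)) *
        ∑ k ∈ Finset.range (m + 1),
          Bcoef (lam + 1 / 2) k m n *
            (Complex.Gamma (2 * lam + n + m - 2 * k + 1) /
              (Nat.factorial (n + m - 2 * k) : ℂ)) *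
            ferrersP ((n : ℂ) + m - 2 * k + lam) lam x := by
  have hσ : 0 < (lam + 1 / 2).re := by
    simp only [Complex.add_re, Complex.div_ofNat_re, Complex.one_re]
    linarith
  have h2σ : 0 < (2 * lam + 1).re := by
    simp only [Complex.add_re, Complex.mul_re, Complex.re_ofNat, Complex.im_ofNat, zero_mul, sub_zero,
      Complex.one_re]
    linarith
  have hc : 0 < (lam + 1).re := by
    simp only [Complex.add_re, Complex.one_re]
    linarith
  set z : ℂ := (((1 - x) / 2 : ℝ) : ℂ) with hzdef
  have hz : ‖z‖ < 1 := by
    rw [hzdef, Complex.norm_real, Real.norm_of_nonneg (by linarith [hx.2])]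
    linarith [hx.1]
  set q : ℕ → ℂ := fun k => hyp2F1 (-((k : ℂ) + lam)) ((k : ℂ) + lam + 1) (lam + 1) z with hqdef
  set E : ℂ := 1 / Complex.Gamma (lam + 1) * (((1 - x) / (1 + x) : ℝ) : ℂ) ^ (lam / 2) with hE
  have hP (k : ℕ) : ferrersP ((k : ℂ) + lam) lam x = E * q k := rfl
  have hlin := pochRatio_mul_mul_eq_linSum (q := q) hσ (hyp2F1_gegenbauer_recurrence hc hz) n m hnm
  have hq0 : q 0 = (1 - z) ^ lam := by
    simp only [hqdef, Nat.cast_zero, zero_add]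
    exact hyp2F1_neg_self hc hz
  have hsum : ∑ k ∈ Finset.range (m + 1), Bcoef (lam + 1 / 2) k m n *
      (Complex.Gamma (2 * lam + n + m - 2 * k + 1) / (Nat.factorial (n + m - 2 * k) : ℂ)) *
        ferrersP ((n : ℂ) + m - 2 * k + lam) lam x =
      Complex.Gamma (2 * lam + 1) * E * linSum (lam + 1 / 2) q m n := by
    rw [linSum, Finset.mul_sum]
    refine Finset.sum_congr rfl fun k hk => ?_
    have hkm : k ≤ m := Nat.lt_succ_iff.mp (Finset.mem_range.mp hk)
    rw [Bcoef_mul_Gamma_div_factorial hσ hkm (hkm.trans hnm),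
      show (n : ℂ) + m - 2 * k = ((m + n - 2 * k : ℕ) : ℂ) by
        rw [Nat.cast_sub (by omega)]; push_cast; ring, hP]
    ring
  have hconst : E * q 0 * ((Real.sqrt Real.pi : ℂ) * Complex.Gamma (2 * lam + 1)) =
      2 ^ lam * Complex.Gamma (lam + 1 / 2) * ((1 - x ^ 2 : ℝ) : ℂ) ^ (lam / 2) := by
    rw [← Gamma_half_add_mul_Gamma_add_one, ← cpow_half_mul_cpow hx, hq0, hE, ← hzdef]
    have := Complex.Gamma_ne_zero_of_re_pos hc
    field_simp
  have hΓ (k : ℕ) : Complex.Gamma (2 * lam + k + 1) =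
      pochRatio (2 * (lam + 1 / 2)) k * (Nat.factorial k : ℂ) * Complex.Gamma (2 * lam + 1) := by
    rw [show 2 * lam + k + 1 = 2 * lam + 1 + k by ring, cpoch_mul_Gamma h2σ, pochRatio,
      div_mul_cancel₀ _ (Nat.cast_ne_zero.mpr k.factorial_ne_zero),
      show 2 * (lam + 1 / 2) = 2 * lam + 1 by ring]
  have hpr (k : ℕ) : pochRatio (2 * (lam + 1 / 2)) k ≠ 0 := by
    rw [show 2 * (lam + 1 / 2) = 2 * lam + 1 by ring]
    exact div_ne_zero (cpoch_ne_zero_of_re_pos h2σ k) (Nat.cast_ne_zero.mpr k.factorial_ne_zero)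
  have hπ : (Real.sqrt Real.pi : ℂ) ≠ 0 :=
    Complex.ofReal_ne_zero.mpr (Real.sqrt_ne_zero'.mpr Real.pi_pos)
  have hΓ0 := Complex.Gamma_ne_zero_of_re_pos h2σ
  have hf (k : ℕ) : (Nat.factorial k : ℂ) ≠ 0 := Nat.cast_ne_zero.mpr k.factorial_ne_zero
  rw [hsum, hP, hP, hΓ, hΓ, div_mul_eq_mul_div, eq_div_iff (mul_ne_zero (mul_ne_zero hπ
    (mul_ne_zero (mul_ne_zero (hpr m) (hf m)) hΓ0)) (mul_ne_zero (mul_ne_zero (hpr n) (hf n)) hΓ0))]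
  linear_combination
    E ^ 2 * (Real.sqrt Real.pi : ℂ) * Complex.Gamma (2 * lam + 1) ^ 2 *
      (Nat.factorial m : ℂ) * (Nat.factorial n : ℂ) * hlin +
    (Nat.factorial m : ℂ) * (Nat.factorial n : ℂ) * Complex.Gamma (2 * lam + 1) * E *
      linSum (lam + 1 / 2) q m n * hconst
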